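/- Let X = (X₁,…,Xₙ) and Y = (Y₁,…,Yₙ) be random vectors with a common copula C which is positively dependent through the stochastic ordering (PDS). If Xᵢ ≤_icx Yᵢ for each i, then X₁ + ⋯ + Xₙ ≤_icx Y₁ + ⋯ + Yₙ. -/

import Mathlib

open MeasureTheory ProbabilityTheory Set

noncomputable section

variable {Ω Ω' : Type*} [MeasurableSpace Ω] [MeasurableSpace Ω']

/-- Distribution function of a random variable. -/
def distFun (μ : Measure Ω) (X : Ω → ℝ) (x : ℝ) : ℝ := (μ {ω | X ω ≤ x}).toReal

/-- Value-at-Risk at level α: `VaR_α(X) = inf {x | F_X(x) ≥ 1-α}`. -/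
def VaR (μ : Measure Ω) (X : Ω → ℝ) (α : ℝ) : ℝ := sInf {x | 1 - α ≤ distFun μ X x}

/-- Range-Value-at-Risk with parameters α, β (for β > 0). -/
def RVaR (μ : Measure Ω) (X : Ω → ℝ) (α β : ℝ) : ℝ := (1/β) * ∫ s in α..(α+β), VaR μ X s

/-- Usual stochastic order. -/
def le_st (μ : Measure Ω) (X : Ω → ℝ) (ν : Measure Ω') (Y : Ω' → ℝ) : Prop :=
  ∀ f : ℝ → ℝ, Monotone f → Integrable (fun ω => f (X ω)) μ →
    Integrable (fun ω => f (Y ω)) ν → ∫ ω, f (X ω) ∂μ ≤ ∫ ω, f (Y ω) ∂ν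

/-- Convex order. -/
def le_cx (μ : Measure Ω) (X : Ω → ℝ) (ν : Measure Ω') (Y : Ω' → ℝ) : Prop :=
  ∀ f : ℝ → ℝ, ConvexOn ℝ univ f → Integrable (fun ω => f (X ω)) μ →
    Integrable (fun ω => f (Y ω)) ν → ∫ ω, f (X ω) ∂μ ≤ ∫ ω, f (Y ω) ∂ν

/-- Increasing convex order. -/
def le_icx (μ : Measure Ω) (X : Ω → ℝ) (ν : Measure Ω') (Y : Ω' → ℝ) : Prop :=
  ∀ f : ℝ → ℝ, Monotone f → ConvexOn ℝ univ f → Integrable (fun ω => f (X ω)) μ →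
    Integrable (fun ω => f (Y ω)) ν → ∫ ω, f (X ω) ∂μ ≤ ∫ ω, f (Y ω) ∂ν

/-- Admissible ceded loss functions: `0 ≤ f(x) ≤ x` with both `f` and the
retained loss `x - f(x)` increasing. -/
def Ceded (f : ℝ → ℝ) : Prop :=
  Monotone f ∧ Monotone (fun x => x - f x) ∧ ∀ x, 0 ≤ x → 0 ≤ f x ∧ f x ≤ x

/-- Layer reinsurance treaty with deductible `a` and upper bound `b`. -/
def layer (a b x : ℝ) : ℝ := min (max (x - a) 0) b

/-- Joint distribution function of a random vector. -/
def jointCDF {n : ℕ} (μ : Measure Ω) (X : Fin n → Ω → ℝ) (x : Fin n → ℝ) : ℝ :=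
  (μ {ω | ∀ i, X i ω ≤ x i}).toReal

/-- All one-dimensional marginals are uniform on [0,1]. -/
def uniformMarginals {n : ℕ} (ν : Measure (Fin n → ℝ)) : Prop :=
  ∀ i, Measure.map (fun u => u i) ν = volume.restrict (Icc (0:ℝ) 1)

/-- `C` is (the distribution function of) an `n`-dimensional copula. -/
def IsCopula {n : ℕ} (C : (Fin n → ℝ) → ℝ) : Prop :=
  ∃ ν : Measure (Fin n → ℝ), IsProbabilityMeasure ν ∧ uniformMarginals ν ∧
    ∀ x, C x = (ν {u | ∀ i, u i ≤ x i}).toReal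

/-- `C` is a copula of the random vector `X`. -/
def HasCopula {n : ℕ} (μ : Measure Ω) (X : Fin n → Ω → ℝ) (C : (Fin n → ℝ) → ℝ) : Prop :=
  IsCopula C ∧ ∀ x : Fin n → ℝ, jointCDF μ X x = C (fun i => distFun μ (X i) (x i))

/-- Positively dependent through the stochastic ordering: for each `i`,
`E[f(X_{-i}) | X_i = x]` is increasing in `x` for every componentwise increasing `f`
(not depending on coordinate `i`). -/
def PDS {n : ℕ} (μ : Measure Ω) (X : Fin n → Ω → ℝ) : Prop :=
  ∀ i : Fin n, ∀ f : (Fin n → ℝ) → ℝ, Monotone f →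
    (∀ a b : Fin n → ℝ, (∀ j, j ≠ i → a j = b j) → f a = f b) →
    ∃ g : ℝ → ℝ, Monotone g ∧
      (μ[(fun ω => f (fun j => X j ω)) | MeasurableSpace.comap (X i) (borel ℝ)]
        =ᵐ[μ] fun ω => g (X i ω))

/-- `C` is a PDS copula. -/
def IsPDSCopula {n : ℕ} (C : (Fin n → ℝ) → ℝ) : Prop :=
  ∃ ν : Measure (Fin n → ℝ), IsProbabilityMeasure ν ∧ uniformMarginals ν ∧
    (∀ x, C x = (ν {u | ∀ i, u i ≤ x i}).toReal) ∧ PDS ν (fun i u => u i)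

/-- Positive orthant dependence. -/
def POD {n : ℕ} (μ : Measure Ω) (X : Fin n → Ω → ℝ) : Prop :=
  ∀ x : Fin n → ℝ,
    (∏ i, (μ {ω | X i ω ≤ x i}).toReal) ≤ (μ {ω | ∀ i, X i ω ≤ x i}).toReal ∧
    (∏ i, (μ {ω | x i < X i ω}).toReal) ≤ (μ {ω | ∀ i, x i < X i ω}).toReal

/-- A comonotone random vector. -/
def Comonotone {m : ℕ} (Z : Fin m → Ω → ℝ) : Prop :=
  ∀ i j ω ω', 0 ≤ (Z i ω - Z i ω') * (Z j ω - Z j ω')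

lemma upper_le {P Q : Measure ℝ} [IsFiniteMeasure P] [IsFiniteMeasure Q]
    (h : ∀ t : ℚ, P (Ioi (t:ℝ)) ≤ Q (Ioi (t:ℝ))) {A : Set ℝ} (hA : IsUpperSet A) : P A ≤ Q A := by
  by_cases hmin : ∃ a, IsLeast A a
  · obtain ⟨a, ha⟩ := hmin
    have hAe : A = ⋂ q : {q : ℚ // (q:ℝ) < a}, Ioi ((q:ℚ):ℝ) := by
      ext x
      simp only [mem_iInter, mem_Ioi, Subtype.forall]
      constructor
      · intro hx q hq
        exact hq.trans_le (ha.2 hx)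
      · intro hx
        refine hA ?_ ha.1
        by_contra hlt
        push Not at hlt
        obtain ⟨q, hq1, hq2⟩ := exists_rat_btwn hlt
        exact absurd (hx q hq2) (not_lt.2 hq1.le)
    have hne : Nonempty {q : ℚ // (q:ℝ) < a} := by
      obtain ⟨q, hq⟩ := exists_rat_lt a
      exact ⟨⟨q, hq⟩⟩
    have key : ∀ R : Measure ℝ, IsFiniteMeasure R →
        R A = ⨅ q : {q : ℚ // (q:ℝ) < a}, R (Ioi ((q:ℚ):ℝ)) := by
      intro R hR
      conv_lhs => rw [hAe]
      refine Directed.measure_iInter (fun i => measurableSet_Ioi.nullMeasurableSet) ?_ ?_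
      · intro x y
        rcases le_total x y with hxy | hxy
        · exact ⟨y, Ioi_subset_Ioi (by exact_mod_cast hxy), le_rfl⟩
        · exact ⟨x, le_rfl, Ioi_subset_Ioi (by exact_mod_cast hxy)⟩
      · exact ⟨hne.some, measure_ne_top _ _⟩
    rw [key P inferInstance, key Q inferInstance]
    exact iInf_mono fun q => h q
  · have hAe : A = ⋃ q : {q : ℚ // (q:ℝ) ∈ A}, Ioi ((q:ℚ):ℝ) := by
      ext x
      simp only [mem_iUnion, mem_Ioi, Subtype.exists]
      constructor
      · intro hx
        by_contra hcon
        push Not at hcon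
        apply hmin
        refine ⟨x, hx, fun y hy => ?_⟩
        by_contra hlt
        push Not at hlt
        obtain ⟨q, hq1, hq2⟩ := exists_rat_btwn hlt
        exact absurd (hcon q (hA hq1.le hy)) (not_le.2 hq2)
      · rintro ⟨q, hq, hqx⟩
        exact hA hqx.le hq
    have key : ∀ R : Measure ℝ,
        R A = ⨆ q : {q : ℚ // (q:ℝ) ∈ A}, R (Ioi ((q:ℚ):ℝ)) := by
      intro R
      conv_lhs => rw [hAe]
      refine Directed.measure_iUnion ?_
      · intro x y
        rcases le_total x y with hxy | hxy
        · exact ⟨x, le_rfl, Ioi_subset_Ioi (by exact_mod_cast hxy)⟩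
        · exact ⟨y, Ioi_subset_Ioi (by exact_mod_cast hxy), le_rfl⟩
    rw [key P, key Q]
    exact iSup_mono fun q => h q

lemma bdd_integrable {α : Type*} [MeasurableSpace α] {P : Measure α} [IsFiniteMeasure P]
    {φ : α → ℝ} {K : ℝ}
    (hφ : AEStronglyMeasurable φ P) (h0 : ∀ x, 0 ≤ φ x) (hK : ∀ x, φ x ≤ K) : Integrable φ P :=
  Integrable.of_bound hφ K (Filter.Eventually.of_forall fun x => by
    rw [Real.norm_eq_abs, abs_of_nonneg (h0 x)]; exact hK x)

lemma mono_integral_le {P Q : Measure ℝ} [IsFiniteMeasure P] [IsFiniteMeasure Q]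
    (h : ∀ t : ℚ, P (Ioi (t:ℝ)) ≤ Q (Ioi (t:ℝ))) {φ : ℝ → ℝ} {K : ℝ}
    (hφ : Monotone φ) (h0 : ∀ x, 0 ≤ φ x) (hK : ∀ x, φ x ≤ K) :
    ∫ x, φ x ∂P ≤ ∫ x, φ x ∂Q := by
  have hi : ∀ R : Measure ℝ, IsFiniteMeasure R → Integrable φ R := fun R hR =>
    bdd_integrable hφ.measurable.aestronglyMeasurable h0 hK
  have hl : ∫⁻ x, ENNReal.ofReal (φ x) ∂P ≤ ∫⁻ x, ENNReal.ofReal (φ x) ∂Q := by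
    rw [lintegral_eq_lintegral_meas_lt P (Filter.Eventually.of_forall h0) hφ.measurable.aemeasurable,
      lintegral_eq_lintegral_meas_lt Q (Filter.Eventually.of_forall h0) hφ.measurable.aemeasurable]
    refine lintegral_mono fun t => upper_le h ?_
    intro x y hxy hx
    exact lt_of_lt_of_le hx (hφ hxy)
  rw [integral_eq_lintegral_of_nonneg_ae (Filter.Eventually.of_forall h0) hφ.measurable.aestronglyMeasurable,
    integral_eq_lintegral_of_nonneg_ae (Filter.Eventually.of_forall h0) hφ.measurable.aestronglyMeasurable]
  refine ENNReal.toReal_mono ?_ hl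
  rw [← ofReal_integral_eq_lintegral_ofReal (hi Q inferInstance) (Filter.Eventually.of_forall h0)]
  exact ENNReal.ofReal_ne_top

lemma layer_nonneg (m : Measure ℝ) [IsFiniteMeasure m] {D H : ℝ → ℝ} {K : ℝ}
    (hD : Integrable D m) (hH : Monotone H) (h0 : ∀ x, 0 ≤ H x) (hK : ∀ x, H x ≤ K)
    (hA : ∀ A : Set ℝ, IsUpperSet A → 0 ≤ ∫ x in A, D x ∂m) : 0 ≤ ∫ x, H x * D x ∂m := by
  have hK0 : 0 ≤ K := (h0 0).trans (hK 0)
  have e1 : ∀ x, H x * D x = ∫ r in Ioc 0 K, ({x | r < H x} : Set ℝ).indicator D x := by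
    intro x
    have : ∀ r, ({x | r < H x} : Set ℝ).indicator D x = (Iio (H x)).indicator (fun _ => D x) r := by
      intro r
      simp only [indicator, mem_ofPred_eq, mem_Iio]
    simp_rw [this]
    rw [integral_indicator measurableSet_Iio, Measure.restrict_restrict measurableSet_Iio]
    rw [setIntegral_const, smul_eq_mul]
    have : volume.real (Iio (H x) ∩ Ioc 0 K) = H x := by
      have : (Iio (H x) ∩ Ioc 0 K) = Ioo 0 (H x) := by
        ext r
        simp only [mem_inter_iff, mem_Iio, mem_Ioc, mem_Ioo]
        constructor
        · rintro ⟨h1, h2, h3⟩; exact ⟨h2, h1⟩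
        · rintro ⟨h1, h2⟩; exact ⟨h2, h1, h2.le.trans (hK x)⟩
      rw [this, Real.volume_real_Ioo_of_le (h0 x), sub_zero]
    rw [this]
  simp_rw [e1]
  rw [integral_integral_swap]
  · refine integral_nonneg fun r => ?_
    have hup : IsUpperSet {x | r < H x} := fun x y hxy hx => lt_of_lt_of_le hx (hH hxy)
    have hm : MeasurableSet {x | r < H x} := measurableSet_lt measurable_const hH.measurable
    show 0 ≤ ∫ x, ({x | r < H x} : Set ℝ).indicator D x ∂m
    rw [integral_indicator hm]
    exact hA _ hup
  · have hms : MeasurableSet {p : ℝ × ℝ | p.2 < H p.1} :=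
      measurableSet_lt measurable_snd (hH.measurable.comp measurable_fst)
    have : (Function.uncurry fun x r => ({x | r < H x} : Set ℝ).indicator D x) =
      ({p : ℝ × ℝ | p.2 < H p.1}).indicator (fun p => D p.1) := by
      ext ⟨x, r⟩
      simp only [Function.uncurry, indicator, mem_ofPred_eq]
    rw [this]
    exact (hD.comp_fst _).indicator hms

lemma tail_nonneg {a b : ℝ → ℝ} (hb : MonotoneOn b (Ioo 0 1))
    (hai : Integrable a (volume.restrict (Icc (0:ℝ) 1)))
    (hbi : Integrable b (volume.restrict (Icc (0:ℝ) 1)))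
    (hid : ∫ u, a u ∂(volume.restrict (Icc (0:ℝ) 1)) ≤ ∫ u, b u ∂(volume.restrict (Icc (0:ℝ) 1)))
    (hsl : ∀ d : ℝ, ∫ u, max (a u - d) 0 ∂(volume.restrict (Icc (0:ℝ) 1))
      ≤ ∫ u, max (b u - d) 0 ∂(volume.restrict (Icc (0:ℝ) 1)))
    (A : Set ℝ) (hA : IsUpperSet A) :
    0 ≤ ∫ u in A, (b u - a u) ∂(volume.restrict (Icc (0:ℝ) 1)) := by
  have hAm : MeasurableSet A := hA.ordConnected.measurableSet
  have hae : ∀ᵐ u ∂(volume.restrict (Icc (0:ℝ) 1)), u ∈ Ioo (0:ℝ) 1 := by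
    rw [← restrict_Ioo_eq_restrict_Icc]
    exact ae_restrict_mem measurableSet_Ioo
  set m := volume.restrict (Icc (0:ℝ) 1) with hm
  by_cases h1 : ∀ u ∈ Ioo (0:ℝ) 1, u ∈ A
  · rw [← integral_indicator hAm]
    have : A.indicator (fun u => b u - a u) =ᵐ[m] fun u => b u - a u := by
      filter_upwards [hae] with u hu
      rw [indicator_of_mem (h1 u hu)]
    rw [integral_congr_ae this, integral_sub hbi hai]
    linarith
  by_cases h2 : ∀ u ∈ Ioo (0:ℝ) 1, u ∉ A
  · rw [← integral_indicator hAm]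
    have : A.indicator (fun u => b u - a u) =ᵐ[m] fun u => 0 := by
      filter_upwards [hae] with u hu
      rw [indicator_of_notMem (h2 u hu)]
    rw [integral_congr_ae this, integral_zero]
  push Not at h1 h2
  obtain ⟨v, hv, hvA⟩ := h1
  obtain ⟨w, hw, hwA⟩ := h2
  have hlow : ∀ x, x ∉ A → ∀ y ∈ A, x ≤ y := by
    intro x hx y hy
    by_contra hlt
    exact hx (hA (not_le.1 hlt).le hy)
  have hbd : BddBelow A := ⟨v, fun y hy => hlow v hvA y hy⟩
  set p := sInf A with hp
  have hp0 : v ≤ p := le_csInf ⟨w, hwA⟩ (hlow v hvA)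
  have hp1 : p ≤ w := csInf_le hbd hwA
  have hpI : p ∈ Ioo (0:ℝ) 1 := ⟨hv.1.trans_le hp0, hp1.trans_lt hw.2⟩
  set d := b p
  have hposi : ∀ g : ℝ → ℝ, Integrable g m → Integrable (fun u => max (g u - d) 0) m := fun g hg =>
    (hg.sub (integrable_const d)).pos_part
  have eb : ∫ u, max (b u - d) 0 ∂m = ∫ u in A, (b u - d) ∂m := by
    rw [← integral_indicator hAm]
    refine integral_congr_ae ?_
    filter_upwards [hae] with u hu
    by_cases huA : u ∈ A
    · rw [indicator_of_mem huA, max_eq_left]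
      have := hb hpI hu (csInf_le hbd huA)
      linarith
    · rw [indicator_of_notMem huA, max_eq_right]
      have := hb hu hpI (le_csInf ⟨w, hwA⟩ (hlow u huA))
      linarith
  have ea : ∫ u in A, (a u - d) ∂m ≤ ∫ u, max (a u - d) 0 ∂m := by
    rw [← integral_indicator hAm]
    refine integral_mono ((hai.sub (integrable_const d)).indicator hAm) (hposi a hai) ?_
    intro u
    by_cases huA : u ∈ A
    · rw [indicator_of_mem huA]; exact le_max_left _ _
    · rw [indicator_of_notMem huA]; exact le_max_right _ _
  have : ∫ u in A, (b u - a u) ∂m = ∫ u in A, (b u - d) ∂m - ∫ u in A, (a u - d) ∂m := by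
    rw [← integral_sub]
    · congr 1; ext u; ring
    · exact (hbi.sub (integrable_const d)).integrableOn
    · exact (hai.sub (integrable_const d)).integrableOn
  rw [this, ← eb]
  linarith [hsl d]

lemma one_step {α : Type*} [MeasurableSpace α] (ρ : Measure α) [IsProbabilityMeasure ρ]
    (U S : α → ℝ) (hU : Measurable U) (hS : Measurable S) (hSi : Integrable S ρ)
    (hUl : ρ.map U = volume.restrict (Icc (0:ℝ) 1)) (a b : ℝ → ℝ)
    (ham : Measurable a) (hbm : Measurable b)
    (ha : MonotoneOn a (Ioo 0 1)) (hb : MonotoneOn b (Ioo 0 1))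
    (hai : Integrable a (volume.restrict (Icc (0:ℝ) 1)))
    (hbi : Integrable b (volume.restrict (Icc (0:ℝ) 1)))
    (hid : ∫ u, a u ∂(volume.restrict (Icc (0:ℝ) 1)) ≤ ∫ u, b u ∂(volume.restrict (Icc (0:ℝ) 1)))
    (hsl : ∀ d : ℝ, ∫ u, max (a u - d) 0 ∂(volume.restrict (Icc (0:ℝ) 1))
      ≤ ∫ u, max (b u - d) 0 ∂(volume.restrict (Icc (0:ℝ) 1)))
    (hst : ∀ t : ℝ, ∃ g : ℝ → ℝ, Monotone g ∧
      (ρ[(S ⁻¹' Ioi t).indicator (fun _ => (1:ℝ)) | MeasurableSpace.comap U (borel ℝ)]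
        =ᵐ[ρ] fun ω => g (U ω)))
    (F c : ℝ → ℝ) (K : ℝ) (hc : Monotone c) (hc0 : ∀ x, 0 ≤ c x) (hcK : ∀ x, c x ≤ K)
    (hFc : ∀ x y, F x + c x * (y - x) ≤ F y)
    (hFi : ∀ Z : α → ℝ, Integrable Z ρ → Integrable (fun ω => F (Z ω)) ρ) :
    ∫ ω, F (a (U ω) + S ω) ∂ρ ≤ ∫ ω, F (b (U ω) + S ω) ∂ρ := by
  have hae : ∀ᵐ u ∂(volume.restrict (Icc (0:ℝ) 1)), u ∈ Ioo (0:ℝ) 1 := by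
    rw [← restrict_Ioo_eq_restrict_Icc]
    exact ae_restrict_mem measurableSet_Ioo
  set m := volume.restrict (Icc (0:ℝ) 1) with hm
  have haU : Integrable (fun ω => a (U ω)) ρ := by
    have : Integrable a (ρ.map U) := by rw [hUl]; exact hai
    exact this.comp_measurable hU
  have hbU : Integrable (fun ω => b (U ω)) ρ := by
    have : Integrable b (ρ.map U) := by rw [hUl]; exact hbi
    exact this.comp_measurable hU
  set κ := condDistrib S U ρ with hκ
  -- the good set
  have hgood : ∀ᵐ u ∂m, ∀ t : ℚ, (κ u).real (Ioi (t:ℝ)) = (hst t).choose u := by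
    rw [ae_all_iff]
    intro t
    have h1 := condDistrib_ae_eq_condExp (μ := ρ) hU hS (measurableSet_Ioi (a := (t:ℝ)))
    have h2 := (hst t).choose_spec.2
    have hmg := (hst t).choose_spec.1.measurable
    have hmk : Measurable fun u => (κ u).real (Ioi (t:ℝ)) :=
      (Kernel.measurable_coe κ measurableSet_Ioi).ennreal_toReal
    rw [← hUl, ae_map_iff hU.aemeasurable (measurableSet_eq_fun hmk hmg)]
    have hb' : (inferInstance : MeasurableSpace ℝ) = borel ℝ := BorelSpace.measurable_eq
    filter_upwards [h1, h2] with ω e1 e2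
    exact e1.trans e2
  set G : Set ℝ := {u | u ∈ Ioo (0:ℝ) 1 ∧ ∀ t : ℚ, (κ u).real (Ioi (t:ℝ)) = (hst t).choose u} with hG
  have hGae : ∀ᵐ u ∂m, u ∈ G := by
    filter_upwards [hae, hgood] with u h1 h2
    exact ⟨h1, h2⟩
  set H₀ : ℝ → ℝ := fun u => ∫ s, c (a u + s) ∂(κ u) with hH₀
  have hH₀0 : ∀ u, 0 ≤ H₀ u := fun u => integral_nonneg fun s => hc0 _
  have hci : ∀ (P : Measure ℝ) [IsFiniteMeasure P] (x : ℝ), Integrable (fun s => c (x + s)) P := by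
    intro P _ x
    exact bdd_integrable (hc.measurable.comp (measurable_const.add measurable_id)).aestronglyMeasurable
      (fun s => hc0 _) (fun s => hcK _)
  have hH₀K : ∀ u, H₀ u ≤ K := by
    intro u
    calc H₀ u ≤ ∫ s, K ∂(κ u) := integral_mono (hci _ _) (integrable_const K) fun s => hcK _
      _ = K := by simp
  have hmonoG : MonotoneOn H₀ G := by
    intro u hu v hv huv
    have hst' : ∀ t : ℚ, κ u (Ioi (t:ℝ)) ≤ κ v (Ioi (t:ℝ)) := by
      intro t
      have : (κ u).real (Ioi (t:ℝ)) ≤ (κ v).real (Ioi (t:ℝ)) := by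
        rw [hu.2 t, hv.2 t]
        exact (hst t).choose_spec.1 huv
      exact (ENNReal.toReal_le_toReal (measure_ne_top _ _) (measure_ne_top _ _)).1 this
    calc H₀ u ≤ ∫ s, c (a u + s) ∂(κ v) :=
          mono_integral_le hst' (fun x y hxy => hc (by linarith)) (fun s => hc0 _) (fun s => hcK _)
      _ ≤ H₀ v := integral_mono (hci _ _) (hci _ _) fun s => hc (by
          have := ha hu.1 hv.1 huv
          linarith)
  obtain ⟨H₁, hH₁, hEq⟩ := hmonoG.exists_monotone_extension
    ⟨0, by rintro _ ⟨u, _, rfl⟩; exact hH₀0 u⟩ ⟨K, by rintro _ ⟨u, _, rfl⟩; exact hH₀K u⟩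
  have hK0 : 0 ≤ K := (hc0 0).trans (hcK 0)
  set H : ℝ → ℝ := fun u => min (max (H₁ u) 0) K with hHdef
  have hHG : ∀ u ∈ G, H u = H₀ u := by
    intro u hu
    simp only [hHdef]
    rw [← hEq hu, max_eq_left (hH₀0 u), min_eq_left (hH₀K u)]
  have hHm : Monotone H := (hH₁.max monotone_const).min monotone_const
  have hmain : 0 ≤ ∫ u, H u * (b u - a u) ∂m :=
    layer_nonneg m (hbi.sub hai) hHm (fun u => le_min (le_max_right _ _) hK0)
      (fun u => min_le_right _ _) (fun A hA => tail_nonneg hb hai hbi hid hsl A hA)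
  -- integral of product
  have hcm : Measurable fun ω => c (a (U ω) + S ω) :=
    hc.measurable.comp ((ham.comp hU).add hS)
  have hprodI : Integrable (fun ω => c (a (U ω) + S ω) * (b (U ω) - a (U ω))) ρ := by
    refine (hbU.sub haU).bdd_mul (c := K) hcm.aestronglyMeasurable ?_
    refine Filter.Eventually.of_forall fun ω => ?_
    rw [Real.norm_eq_abs, abs_of_nonneg (hc0 _)]; exact hcK _
  have hpm : Measurable fun p : ℝ × ℝ => c (a p.1 + p.2) * (b p.1 - a p.1) :=
    (hc.measurable.comp ((ham.comp measurable_fst).add measurable_snd)).mul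
      ((hbm.comp measurable_fst).sub (ham.comp measurable_fst))
  have hprod : ∫ ω, c (a (U ω) + S ω) * (b (U ω) - a (U ω)) ∂ρ = ∫ u, H u * (b u - a u) ∂m := by
    have hdis : (ρ.map U) ⊗ₘ κ = ρ.map fun ω => (U ω, S ω) :=
      compProd_map_condDistrib (X := U) (μ := ρ) hS.aemeasurable
    have hUS : Measurable fun ω => (U ω, S ω) := hU.prodMk hS
    have e1 : ∫ ω, c (a (U ω) + S ω) * (b (U ω) - a (U ω)) ∂ρ
        = ∫ p, c (a p.1 + p.2) * (b p.1 - a p.1) ∂(ρ.map fun ω => (U ω, S ω)) := by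
      rw [integral_map hUS.aemeasurable hpm.aestronglyMeasurable]
    have hpi : Integrable (fun p : ℝ × ℝ => c (a p.1 + p.2) * (b p.1 - a p.1))
        (ρ.map fun ω => (U ω, S ω)) := by
      rw [integrable_map_measure hpm.aestronglyMeasurable hUS.aemeasurable]
      exact hprodI
    rw [← hdis] at e1 hpi
    rw [e1, Measure.integral_compProd hpi, hUl]
    refine integral_congr_ae ?_
    filter_upwards [hGae] with u hu
    rw [hHG u hu]
    simp only [hH₀]
    rw [integral_mul_const]
  have h1 := hFi _ (haU.add hSi)
  have h2 := hFi _ (hbU.add hSi)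
  have hlow : ∫ ω, (F (a (U ω) + S ω) + c (a (U ω) + S ω) * (b (U ω) - a (U ω))) ∂ρ
      ≤ ∫ ω, F (b (U ω) + S ω) ∂ρ := by
    refine integral_mono (h1.add hprodI) h2 fun ω => ?_
    have := hFc (a (U ω) + S ω) (b (U ω) + S ω)
    have e : b (U ω) + S ω - (a (U ω) + S ω) = b (U ω) - a (U ω) := by ring
    rw [e] at this
    exact this
  have hadd := integral_add h1 hprodI
  simp only [Pi.add_apply] at hadd
  rw [hadd, hprod] at hlow
  linarith

/-- Quantile function on `(0,1)`, set to zero outside. -/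
def quant (P : Measure ℝ) (u : ℝ) : ℝ :=
  open Classical in if u ∈ Ioo (0:ℝ) 1 then sInf {x | u ≤ cdf P x} else 0

lemma quant_le_iff (P : Measure ℝ) {u : ℝ} (hu : u ∈ Ioo (0:ℝ) 1) (x : ℝ) :
    quant P u ≤ x ↔ u ≤ cdf P x := by
  have hne : {x | u ≤ cdf P x}.Nonempty := by
    obtain ⟨y, hy⟩ := ((tendsto_cdf_atTop P).eventually (eventually_gt_nhds hu.2)).exists
    exact ⟨y, hy.le⟩
  have hbd : BddBelow {x | u ≤ cdf P x} := by
    obtain ⟨y, hy⟩ := ((tendsto_cdf_atBot P).eventually (eventually_lt_nhds hu.1)).exists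
    refine ⟨y, fun z hz => ?_⟩
    by_contra hlt
    exact absurd (hz.trans (monotone_cdf P (not_le.1 hlt).le)) (not_le.2 hy)
  rw [quant, if_pos hu]
  constructor
  · intro h
    have hr : ContinuousWithinAt (cdf P) (Ioi x) x :=
      ((cdf P).right_continuous x).mono Ioi_subset_Ici_self
    refine ge_of_tendsto hr ?_
    filter_upwards [self_mem_nhdsWithin] with y hy
    obtain ⟨z, hz, hzy⟩ := exists_lt_of_csInf_lt hne (lt_of_le_of_lt h hy)
    exact le_trans hz (monotone_cdf P hzy.le)
  · intro h
    exact csInf_le hbd h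

lemma quant_monoOn (P : Measure ℝ) : MonotoneOn (quant P) (Ioo 0 1) := by
  intro u hu v hv huv
  rw [quant_le_iff P hu]
  exact huv.trans ((quant_le_iff P hv _).1 le_rfl)

lemma quant_measurable (P : Measure ℝ) : Measurable (quant P) := by
  refine measurable_of_Iic fun x => ?_
  have : quant P ⁻¹' Iic x = (Ioo (0:ℝ) 1 ∩ Iic (cdf P x)) ∪ ((Ioo (0:ℝ) 1)ᶜ ∩ {_u : ℝ | (0:ℝ) ≤ x}) := by
    ext u
    by_cases hu : u ∈ Ioo (0:ℝ) 1
    · have := quant_le_iff P hu x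
      simp only [mem_preimage, mem_Iic, mem_union, mem_inter_iff, mem_compl_iff]
      tauto
    · have : quant P u = 0 := by rw [quant, if_neg hu]
      simp only [mem_preimage, mem_Iic, mem_union, mem_inter_iff, mem_compl_iff, this, mem_ofPred_eq]
      tauto
  rw [this]
  exact (measurableSet_Ioo.inter measurableSet_Iic).union
    (measurableSet_Ioo.compl.inter (MeasurableSet.const _))

lemma ext_of_boxes {n : ℕ} {P Q : Measure (Fin n → ℝ)} [IsProbabilityMeasure P] [IsProbabilityMeasure Q]
    (h : ∀ x : Fin n → ℝ, P {u | ∀ i, u i ≤ x i} = Q {u | ∀ i, u i ≤ x i}) : P = Q := by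
  have hgen : ∀ _ : Fin n, MeasurableSpace.generateFrom (range (Iic : ℝ → Set ℝ)) =
      (inferInstance : MeasurableSpace ℝ) := fun _ => by
    rw [← borel_eq_generateFrom_Iic]; exact BorelSpace.measurable_eq.symm
  have hsp : ∀ _ : Fin n, IsCountablySpanning (range (Iic : ℝ → Set ℝ)) := fun _ =>
    ⟨fun k : ℕ => Iic (k:ℝ), fun k => ⟨_, rfl⟩, by
      rw [eq_univ_iff_forall]
      intro x
      obtain ⟨k, hk⟩ := exists_nat_ge x
      exact mem_iUnion.2 ⟨k, hk⟩⟩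
  refine ext_of_generate_finite _ (generateFrom_eq_pi hgen hsp).symm
    (IsPiSystem.pi fun _ => isPiSystem_Iic) ?_ (by simp)
  rintro _ ⟨s, hs, rfl⟩
  have : ∀ i, ∃ x, Iic x = s i := fun i => hs i (mem_univ i)
  choose x hx using this
  have e : pi univ s = {u : Fin n → ℝ | ∀ i, u i ≤ x i} := by
    ext u
    simp only [mem_pi, mem_univ, true_imp_iff, ← hx, mem_Iic, mem_ofPred_eq]
  rw [e]
  exact h x

lemma exists_slopes {f : ℝ → ℝ} (hf : Monotone f) (hcx : ConvexOn ℝ univ f) :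
    ∃ c : ℝ → ℝ, Monotone c ∧ (∀ x, 0 ≤ c x) ∧ ∀ x y, f x + c x * (y - x) ≤ f y := by
  have hint : ∀ x : ℝ, x ∈ interior (univ : Set ℝ) := fun x => by simp
  refine ⟨fun x => derivWithin f (Ioi x) x, ?_, ?_, ?_⟩
  · intro x y hxy
    exact hcx.monotoneOn_rightDeriv (hint x) (hint y) hxy
  · intro x
    exact hf.monotoneOn _ |>.derivWithin_nonneg
  · intro x y
    rcases lt_trichotomy x y with h | h | h
    · have := hcx.rightDeriv_le_slope_of_mem_interior (hint x) (mem_univ y) h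
      rw [slope_def_field, le_div_iff₀ (by linarith)] at this
      linarith
    · subst h; simp
    · have h1 := hcx.leftDeriv_le_rightDeriv_of_mem_interior (hint x)
      have h2 := hcx.slope_le_leftDeriv_of_mem_interior (mem_univ y) (hint x) h
      have := h2.trans h1
      rw [slope_def_field, div_le_iff₀ (by linarith)] at this
      simp only at this ⊢
      linarith

lemma lip_of_slopes {F c : ℝ → ℝ} {K : ℝ} (hc0 : ∀ x, 0 ≤ c x) (hcK : ∀ x, c x ≤ K)
    (hFc : ∀ x y, F x + c x * (y - x) ≤ F y) (x y : ℝ) : |F x - F y| ≤ K * |x - y| := by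
  have h1 := hFc x y
  have h2 := hFc y x
  have a1 : c x * (x - y) ≤ K * |x - y| :=
    by
      calc c x * (x - y) ≤ c x * |x - y| := mul_le_mul_of_nonneg_left (le_abs_self _) (hc0 x)
        _ ≤ K * |x - y| := mul_le_mul_of_nonneg_right (hcK x) (abs_nonneg _)
  have a2 : c y * (y - x) ≤ K * |x - y| := by
    calc c y * (y - x) ≤ c y * |x - y| := by
          rw [abs_sub_comm]; exact mul_le_mul_of_nonneg_left (le_abs_self _) (hc0 y)
      _ ≤ K * |x - y| := mul_le_mul_of_nonneg_right (hcK y) (abs_nonneg _)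
  rw [abs_le]
  constructor <;> nlinarith

lemma cont_of_slopes {F c : ℝ → ℝ} {K : ℝ} (hc0 : ∀ x, 0 ≤ c x) (hcK : ∀ x, c x ≤ K)
    (hFc : ∀ x y, F x + c x * (y - x) ≤ F y) : Continuous F := by
  have hK0 : 0 ≤ K := (hc0 0).trans (hcK 0)
  have : LipschitzWith ⟨K, hK0⟩ F := LipschitzWith.of_dist_le_mul fun x y => by
    rw [Real.dist_eq, Real.dist_eq]
    exact lip_of_slopes hc0 hcK hFc x y
  exact this.continuous

lemma integrable_of_slopes {α : Type*} [MeasurableSpace α] (ρ : Measure α) [IsProbabilityMeasure ρ]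
    {F c : ℝ → ℝ} {K : ℝ} (hc0 : ∀ x, 0 ≤ c x) (hcK : ∀ x, c x ≤ K)
    (hFc : ∀ x y, F x + c x * (y - x) ≤ F y) (Z : α → ℝ) (hZ : Integrable Z ρ) :
    Integrable (fun ω => F (Z ω)) ρ := by
  have hF := cont_of_slopes hc0 hcK hFc
  refine Integrable.mono' (g := fun ω => |F 0| + K * |Z ω|)
    ((integrable_const _).add (hZ.abs.const_mul K)) (hF.comp_aestronglyMeasurable hZ.1) ?_
  refine Filter.Eventually.of_forall fun ω => ?_
  have := lip_of_slopes hc0 hcK hFc (Z ω) 0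
  rw [sub_zero] at this
  rw [Real.norm_eq_abs]
  have h2 : |F (Z ω)| ≤ |F (Z ω) - F 0| + |F 0| := by
    calc |F (Z ω)| = |(F (Z ω) - F 0) + F 0| := by ring_nf
      _ ≤ _ := abs_add_le _ _
  linarith

lemma ae_cube {n : ℕ} (ρ : Measure (Fin n → ℝ)) (hunif : uniformMarginals ρ) :
    ∀ᵐ u ∂ρ, ∀ j, u j ∈ Ioo (0:ℝ) 1 := by
  rw [ae_all_iff]
  intro j
  have hae : ∀ᵐ u ∂(volume.restrict (Icc (0:ℝ) 1)), u ∈ Ioo (0:ℝ) 1 := by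
    rw [← restrict_Ioo_eq_restrict_Icc]
    exact ae_restrict_mem measurableSet_Ioo
  rw [← hunif j] at hae
  exact ae_of_ae_map (measurable_pi_apply j).aemeasurable hae

lemma pds_tail {n : ℕ} (ρ : Measure (Fin n → ℝ)) [IsProbabilityMeasure ρ]
    (hunif : uniformMarginals ρ) (hPDS : PDS ρ (fun i u => u i))
    (z : Fin n → ℝ → ℝ) (hz : ∀ j, MonotoneOn (z j) (Ioo 0 1)) (i : Fin n) (t : ℝ) :
    ∃ g : ℝ → ℝ, Monotone g ∧
      (ρ[((fun u : Fin n → ℝ => ∑ j ∈ Finset.univ.erase i, z j (u j)) ⁻¹' Ioi t).indicator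
          (fun _ => (1:ℝ)) | MeasurableSpace.comap (fun u : Fin n → ℝ => u i) (borel ℝ)]
        =ᵐ[ρ] fun u => g (u i)) := by
  classical
  set B : Set (Fin n → ℝ) := {u | ∃ v : Fin n → ℝ, (∀ j, v j ∈ Ioo (0:ℝ) 1) ∧
    t < ∑ j ∈ Finset.univ.erase i, z j (v j) ∧ ∀ j, j ≠ i → v j ≤ u j} with hB
  have hmon : Monotone (B.indicator fun _ => (1:ℝ)) := by
    intro u w huw
    by_cases h : u ∈ B
    · have hw : w ∈ B := by
        obtain ⟨v, hv, hvt, hvu⟩ := h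
        exact ⟨v, hv, hvt, fun j hj => (hvu j hj).trans (huw j)⟩
      rw [indicator_of_mem h, indicator_of_mem hw]
    · rw [indicator_of_notMem h]
      exact indicator_nonneg (fun _ _ => zero_le_one) w
  have hdep : ∀ u w : Fin n → ℝ, (∀ j, j ≠ i → u j = w j) →
      B.indicator (fun _ => (1:ℝ)) u = B.indicator (fun _ => (1:ℝ)) w := by
    intro u w huw
    have : u ∈ B ↔ w ∈ B := by
      constructor
      · rintro ⟨v, hv, hvt, hvu⟩
        exact ⟨v, hv, hvt, fun j hj => (hvu j hj).trans (huw j hj).le⟩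
      · rintro ⟨v, hv, hvt, hvu⟩
        exact ⟨v, hv, hvt, fun j hj => (hvu j hj).trans (huw j hj).ge⟩
    by_cases h : u ∈ B
    · rw [indicator_of_mem h, indicator_of_mem (this.1 h)]
    · rw [indicator_of_notMem h, indicator_of_notMem (fun h' => h (this.2 h'))]
  obtain ⟨g, hg, hge⟩ := hPDS i (B.indicator fun _ => (1:ℝ)) hmon hdep
  refine ⟨g, hg, Filter.EventuallyEq.trans (condExp_congr_ae ?_) hge⟩
  filter_upwards [ae_cube ρ hunif] with u hu
  have : u ∈ (fun u : Fin n → ℝ => ∑ j ∈ Finset.univ.erase i, z j (u j)) ⁻¹' Ioi t ↔ u ∈ B := by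
    constructor
    · intro h
      exact ⟨u, hu, h, fun j _ => le_rfl⟩
    · rintro ⟨v, hv, hvt, hvu⟩
      refine lt_of_lt_of_le hvt (Finset.sum_le_sum fun j hj => ?_)
      exact hz j (hv j) (hu j) (hvu j (Finset.ne_of_mem_erase hj))
  by_cases h : u ∈ B
  · rw [indicator_of_mem (this.2 h), indicator_of_mem h]
  · rw [indicator_of_notMem (fun h' => h (this.1 h')), indicator_of_notMem h]

lemma chain_le {n : ℕ} (ρ : Measure (Fin n → ℝ)) [IsProbabilityMeasure ρ]
    (hunif : uniformMarginals ρ) (hPDS : PDS ρ (fun i u => u i))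
    (a b : Fin n → ℝ → ℝ) (ham : ∀ i, Measurable (a i)) (hbm : ∀ i, Measurable (b i))
    (ha : ∀ i, MonotoneOn (a i) (Ioo 0 1)) (hb : ∀ i, MonotoneOn (b i) (Ioo 0 1))
    (hai : ∀ i, Integrable (a i) (volume.restrict (Icc (0:ℝ) 1)))
    (hbi : ∀ i, Integrable (b i) (volume.restrict (Icc (0:ℝ) 1)))
    (hid : ∀ i, ∫ u, a i u ∂(volume.restrict (Icc (0:ℝ) 1))
      ≤ ∫ u, b i u ∂(volume.restrict (Icc (0:ℝ) 1)))
    (hsl : ∀ i, ∀ d : ℝ, ∫ u, max (a i u - d) 0 ∂(volume.restrict (Icc (0:ℝ) 1))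
      ≤ ∫ u, max (b i u - d) 0 ∂(volume.restrict (Icc (0:ℝ) 1)))
    (F c : ℝ → ℝ) (K : ℝ) (hc : Monotone c) (hc0 : ∀ x, 0 ≤ c x) (hcK : ∀ x, c x ≤ K)
    (hFc : ∀ x y, F x + c x * (y - x) ≤ F y) :
    ∫ u, F (∑ i, a i (u i)) ∂ρ ≤ ∫ u, F (∑ i, b i (u i)) ∂ρ := by
  classical
  have hind : ∀ s : Finset (Fin n), ∫ u, F (∑ i, a i (u i)) ∂ρ ≤
      ∫ u, F (∑ i, (if i ∈ s then b i else a i) (u i)) ∂ρ := by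
    intro s
    induction s using Finset.induction_on with
    | empty => simp
    | insert i s his ih =>
      refine ih.trans ?_
      set z : Fin n → ℝ → ℝ := fun j => if j ∈ s then b j else a j with hz
      have hzm : ∀ j, Measurable (z j) := fun j => by
        simp only [hz]; split_ifs; exacts [hbm j, ham j]
      have hzmono : ∀ j, MonotoneOn (z j) (Ioo 0 1) := fun j => by
        simp only [hz]; split_ifs; exacts [hb j, ha j]
      have hzi : ∀ j, Integrable (z j) (volume.restrict (Icc (0:ℝ) 1)) := fun j => by
        simp only [hz]; split_ifs; exacts [hbi j, hai j]
      have hzi' : ∀ j, Integrable (fun u : Fin n → ℝ => z j (u j)) ρ := fun j => by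
        have := hzi j
        rw [← hunif j] at this
        exact this.comp_measurable (measurable_pi_apply j)
      have hstep := one_step ρ (fun u => u i)
        (fun u : Fin n → ℝ => ∑ j ∈ Finset.univ.erase i, z j (u j))
        (measurable_pi_apply i)
        (Finset.measurable_fun_sum _ fun j _ => (hzm j).comp (measurable_pi_apply j))
        (integrable_finsetSum _ fun j _ => hzi' j)
        (hunif i) (a i) (b i) (ham i) (hbm i) (ha i) (hb i) (hai i) (hbi i) (hid i) (hsl i)
        (fun t => pds_tail ρ hunif hPDS z hzmono i t) F c K hc hc0 hcK hFc
        (integrable_of_slopes ρ hc0 hcK hFc)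
      have e1 : ∀ u : Fin n → ℝ, ∑ j, z j (u j) =
          a i (u i) + ∑ j ∈ Finset.univ.erase i, z j (u j) := by
        intro u
        rw [← Finset.add_sum_erase _ _ (Finset.mem_univ i)]
        simp only [hz, if_neg his]
      have e2 : ∀ u : Fin n → ℝ, ∑ j, (if j ∈ insert i s then b j else a j) (u j) =
          b i (u i) + ∑ j ∈ Finset.univ.erase i, z j (u j) := by
        intro u
        rw [← Finset.add_sum_erase _ _ (Finset.mem_univ i)]
        congr 1
        · simp
        · refine Finset.sum_congr rfl fun j hj => ?_
          have hji := Finset.ne_of_mem_erase hj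
          simp only [hz, Finset.mem_insert, hji, false_or]
      have e1' : (fun u : Fin n → ℝ => F (∑ j, z j (u j))) = fun u =>
          F (a i (u i) + ∑ j ∈ Finset.univ.erase i, z j (u j)) := funext fun u => by rw [e1 u]
      have e2' : (fun u : Fin n → ℝ => F (∑ j, (if j ∈ insert i s then b j else a j) (u j))) =
          fun u => F (b i (u i) + ∑ j ∈ Finset.univ.erase i, z j (u j)) :=
        funext fun u => by rw [e2 u]
      rw [e1', e2']
      exact hstep
  simpa using hind Finset.univ

lemma law_eq {Ω : Type*} [MeasurableSpace Ω] {n : ℕ} (μ : Measure Ω) [IsProbabilityMeasure μ]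
    (X : Fin n → Ω → ℝ) (hXm : ∀ i, Measurable (X i))
    (ρ : Measure (Fin n → ℝ)) [IsProbabilityMeasure ρ] (hunif : uniformMarginals ρ)
    (h : ∀ x : Fin n → ℝ, jointCDF μ X x =
      (ρ {u | ∀ i, u i ≤ distFun μ (X i) (x i)}).toReal) :
    μ.map (fun ω i => X i ω) = ρ.map (fun u i => quant (μ.map (X i)) (u i)) := by
  have hm1 : Measurable fun ω i => X i ω := measurable_pi_lambda _ hXm
  have hm2 : Measurable fun (u : Fin n → ℝ) i => quant (μ.map (X i)) (u i) :=
    measurable_pi_lambda _ fun i => (quant_measurable _).comp (measurable_pi_apply i)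
  have := Measure.isProbabilityMeasure_map (μ := μ) hm1.aemeasurable
  have := Measure.isProbabilityMeasure_map (μ := ρ) hm2.aemeasurable
  refine ext_of_boxes fun x => ?_
  have hbox : MeasurableSet {u : Fin n → ℝ | ∀ i, u i ≤ x i} := by
    have : {u : Fin n → ℝ | ∀ i, u i ≤ x i} = Iic x := by ext u; simp [Pi.le_def]
    rw [this]; exact measurableSet_Iic
  rw [Measure.map_apply hm1 hbox, Measure.map_apply hm2 hbox]
  have e1 : μ ((fun ω i => X i ω) ⁻¹' {u : Fin n → ℝ | ∀ i, u i ≤ x i}) =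
      ρ {u | ∀ i, u i ≤ distFun μ (X i) (x i)} := by
    have := h x
    rw [jointCDF, ENNReal.toReal_eq_toReal_iff' (measure_ne_top _ _) (measure_ne_top _ _)] at this
    exact this
  rw [e1]
  refine measure_congr ?_
  filter_upwards [ae_cube ρ hunif] with u hu
  refine propext (forall_congr' fun i => ?_)
  have := Measure.isProbabilityMeasure_map (μ := μ) (hXm i).aemeasurable
  show u i ≤ distFun μ (X i) (x i) ↔ quant (μ.map (X i)) (u i) ≤ x i
  rw [quant_le_iff _ (hu i), cdf_eq_real, map_measureReal_apply (hXm i) measurableSet_Iic]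
  rfl

lemma marg_eq {Ω : Type*} [MeasurableSpace Ω] {n : ℕ} (μ : Measure Ω)
    (X : Fin n → Ω → ℝ) (hXm : ∀ i, Measurable (X i))
    (ρ : Measure (Fin n → ℝ)) (hunif : uniformMarginals ρ)
    (h : μ.map (fun ω i => X i ω) = ρ.map (fun u i => quant (μ.map (X i)) (u i))) (i : Fin n) :
    μ.map (X i) = (volume.restrict (Icc (0:ℝ) 1)).map (quant (μ.map (X i))) := by
  have hm1 : Measurable fun ω i => X i ω := measurable_pi_lambda _ hXm
  have hm2 : Measurable fun (u : Fin n → ℝ) i => quant (μ.map (X i)) (u i) :=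
    measurable_pi_lambda _ fun i => (quant_measurable _).comp (measurable_pi_apply i)
  have hproj := congrArg (fun P => Measure.map (fun u : Fin n → ℝ => u i) P) h
  rw [Measure.map_map (measurable_pi_apply i) hm1, Measure.map_map (measurable_pi_apply i) hm2] at hproj
  rw [← hunif i, Measure.map_map (quant_measurable _) (measurable_pi_apply i)]
  exact hproj

/-- linear truncation of `f` above `k` -/
def trunc (f c : ℝ → ℝ) (k x : ℝ) : ℝ := f (min x k) + c k * (x - min x k)

lemma trunc_slopes {f c : ℝ → ℝ} (hc : Monotone c)
    (hfc : ∀ x y, f x + c x * (y - x) ≤ f y) (k x y : ℝ) :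
    trunc f c k x + c (min x k) * (y - x) ≤ trunc f c k y := by
  unfold trunc
  rcases le_total x k with hx | hx <;> rcases le_total y k with hy | hy
  · rw [min_eq_left hx, min_eq_left hy]
    have := hfc x y
    linarith
  · rw [min_eq_left hx, min_eq_right hy]
    have h1 := hfc x k
    have h2 : c x * (y - k) ≤ c k * (y - k) :=
      mul_le_mul_of_nonneg_right (hc hx) (by linarith)
    linarith
  · rw [min_eq_right hx, min_eq_left hy]
    have h1 := hfc k y
    linarith
  · rw [min_eq_right hx, min_eq_right hy]
    linarith

lemma trunc_le {f c : ℝ → ℝ} (hfc : ∀ x y, f x + c x * (y - x) ≤ f y) (k x : ℝ) :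
    trunc f c k x ≤ f x := by
  unfold trunc
  rcases le_total x k with hx | hx
  · rw [min_eq_left hx]; linarith
  · rw [min_eq_right hx]; exact hfc k x

lemma trunc_tendsto {Ω : Type*} [MeasurableSpace Ω] (μ : Measure Ω) [IsProbabilityMeasure μ]
    {f c : ℝ → ℝ} (hc : Monotone c) (hc0 : ∀ x, 0 ≤ c x)
    (hfc : ∀ x y, f x + c x * (y - x) ≤ f y) (Z : Ω → ℝ) (hZ : Integrable Z μ)
    (hf : Integrable (fun ω => f (Z ω)) μ) :
    Filter.Tendsto (fun k : ℕ => ∫ ω, trunc f c k (Z ω) ∂μ) Filter.atTop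
      (nhds (∫ ω, f (Z ω) ∂μ)) := by
  refine tendsto_integral_of_dominated_convergence
    (fun ω => |f (Z ω)| + (|f 0| + c 0 * |Z ω|)) ?_ ?_ ?_ ?_
  · intro k
    have : Continuous (trunc f c k) := cont_of_slopes (c := fun x => c (min x k)) (K := c k)
      (fun x => hc0 _) (fun x => hc (min_le_right _ _)) (trunc_slopes hc hfc k)
    exact this.comp_aestronglyMeasurable hZ.1
  · exact hf.abs.add ((integrable_const _).add (hZ.abs.const_mul _))
  · intro k
    refine Filter.Eventually.of_forall fun ω => ?_
    have h1 := trunc_le hfc k (Z ω)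
    have h2 := trunc_slopes hc hfc k 0 (Z ω)
    have hk : min (0:ℝ) k = 0 := min_eq_left (Nat.cast_nonneg k)
    have h3 : trunc f c k 0 = f 0 := by
      unfold trunc; rw [hk]; ring
    rw [hk, h3, sub_zero] at h2
    have h4 : -(c 0 * |Z ω|) ≤ c 0 * Z ω := by
      rw [← mul_neg]; exact mul_le_mul_of_nonneg_left (neg_abs_le _) (hc0 0)
    have h5 := le_abs_self (f (Z ω))
    have h6 := neg_abs_le (f 0)
    have h7 := abs_nonneg (f (Z ω))
    have h8 := abs_nonneg (f 0)
    have h9 : 0 ≤ c 0 * |Z ω| := mul_nonneg (hc0 0) (abs_nonneg _)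
    rw [Real.norm_eq_abs, abs_le]
    constructor <;> linarith
  · refine Filter.Eventually.of_forall fun ω => ?_
    refine tendsto_const_nhds.congr' ?_
    obtain ⟨N, hN⟩ := exists_nat_ge (Z ω)
    filter_upwards [Filter.eventually_ge_atTop N] with k hk
    have : Z ω ≤ k := hN.trans (by exact_mod_cast hk)
    unfold trunc
    rw [min_eq_left this]; ring

/-- common PDS copula and componentwise `≤_icx` imply `≤_icx` of the sums. -/
theorem sum_le_icx_of_common_PDS_copula
    {n : ℕ} (μ : Measure Ω) (ν : Measure Ω')
    [IsProbabilityMeasure μ] [IsProbabilityMeasure ν]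
    (X : Fin n → Ω → ℝ) (Y : Fin n → Ω' → ℝ)
    (hXm : ∀ i, Measurable (X i)) (hYm : ∀ i, Measurable (Y i))
    (hXi : ∀ i, Integrable (X i) μ) (hYi : ∀ i, Integrable (Y i) ν)
    (C : (Fin n → ℝ) → ℝ) (hCPDS : IsPDSCopula C)
    (hX : HasCopula μ X C) (hY : HasCopula ν Y C)
    (hicx : ∀ i, le_icx μ (X i) ν (Y i)) :
    le_icx μ (fun ω => ∑ i, X i ω) ν (fun ω => ∑ i, Y i ω) := by
  obtain ⟨ρ, hρ, hunif, hCρ, hPDS⟩ := hCPDS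
  have lawX := law_eq μ X hXm ρ hunif fun x => by rw [hX.2 x, hCρ]
  have lawY := law_eq ν Y hYm ρ hunif fun x => by rw [hY.2 x, hCρ]
  have mX := marg_eq μ X hXm ρ hunif lawX
  have mY := marg_eq ν Y hYm ρ hunif lawY
  set a : Fin n → ℝ → ℝ := fun i => quant (μ.map (X i)) with ha
  set b : Fin n → ℝ → ℝ := fun i => quant (ν.map (Y i)) with hb
  have ham : ∀ i, Measurable (a i) := fun i => quant_measurable _
  have hbm : ∀ i, Measurable (b i) := fun i => quant_measurable _
  have mX' : ∀ i, μ.map (X i) = (volume.restrict (Icc (0:ℝ) 1)).map (a i) := mX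
  have mY' : ∀ i, ν.map (Y i) = (volume.restrict (Icc (0:ℝ) 1)).map (b i) := mY
  have tX : ∀ i (φ : ℝ → ℝ), Measurable φ →
      ∫ ω, φ (X i ω) ∂μ = ∫ u, φ (a i u) ∂(volume.restrict (Icc (0:ℝ) 1)) := by
    intro i φ hφ
    rw [← integral_map (hXm i).aemeasurable hφ.aestronglyMeasurable, mX' i,
      integral_map (ham i).aemeasurable hφ.aestronglyMeasurable]
  have tY : ∀ i (φ : ℝ → ℝ), Measurable φ →
      ∫ ω, φ (Y i ω) ∂ν = ∫ u, φ (b i u) ∂(volume.restrict (Icc (0:ℝ) 1)) := by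
    intro i φ hφ
    rw [← integral_map (hYm i).aemeasurable hφ.aestronglyMeasurable, mY' i,
      integral_map (hbm i).aemeasurable hφ.aestronglyMeasurable]
  have hai : ∀ i, Integrable (a i) (volume.restrict (Icc (0:ℝ) 1)) := by
    intro i
    have h1 : Integrable id (μ.map (X i)) :=
      (integrable_map_measure measurable_id.aestronglyMeasurable (hXm i).aemeasurable).2 (hXi i)
    rw [mX' i] at h1
    exact h1.comp_measurable (ham i)
  have hbi : ∀ i, Integrable (b i) (volume.restrict (Icc (0:ℝ) 1)) := by
    intro i
    have h1 : Integrable id (ν.map (Y i)) :=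
      (integrable_map_measure measurable_id.aestronglyMeasurable (hYm i).aemeasurable).2 (hYi i)
    rw [mY' i] at h1
    exact h1.comp_measurable (hbm i)
  have hid : ∀ i, ∫ u, a i u ∂(volume.restrict (Icc (0:ℝ) 1))
      ≤ ∫ u, b i u ∂(volume.restrict (Icc (0:ℝ) 1)) := by
    intro i
    have := hicx i (fun x => x) monotone_id (convexOn_id convex_univ) (hXi i) (hYi i)
    rw [tX i _ measurable_id', tY i _ measurable_id'] at this
    exact this
  have hsl : ∀ i, ∀ d : ℝ, ∫ u, max (a i u - d) 0 ∂(volume.restrict (Icc (0:ℝ) 1))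
      ≤ ∫ u, max (b i u - d) 0 ∂(volume.restrict (Icc (0:ℝ) 1)) := by
    intro i d
    have hmono : Monotone fun x : ℝ => max (x - d) 0 := fun x y hxy =>
      max_le_max (by linarith) le_rfl
    have hcv : ConvexOn ℝ univ fun x : ℝ => max (x - d) 0 :=
      ((convexOn_id convex_univ).sub (concaveOn_const d convex_univ)).sup
        (convexOn_const 0 convex_univ)
    have := hicx i (fun x => max (x - d) 0) hmono hcv
      ((hXi i).sub (integrable_const d)).pos_part ((hYi i).sub (integrable_const d)).pos_part
    rw [tX i _ hmono.measurable, tY i _ hmono.measurable] at this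
    exact this
  intro f hf hcx hfX hfY
  obtain ⟨c, hc, hc0, hfc⟩ := exists_slopes hf hcx
  have limX := trunc_tendsto μ hc hc0 hfc (fun ω => ∑ i, X i ω)
    (integrable_finsetSum _ fun i _ => hXi i) hfX
  have limY := trunc_tendsto ν hc hc0 hfc (fun ω => ∑ i, Y i ω)
    (integrable_finsetSum _ fun i _ => hYi i) hfY
  refine le_of_tendsto_of_tendsto' limX limY fun k => ?_
  have hsl' := trunc_slopes hc hfc (k:ℝ)
  have hck : ∀ x : ℝ, c (min x k) ≤ c k := fun x => hc (min_le_right _ _)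
  have hcont : Continuous (trunc f c k) :=
    cont_of_slopes (c := fun x => c (min x k)) (fun x => hc0 _) hck hsl'
  have hchain := chain_le ρ hunif hPDS a b ham hbm (fun i => quant_monoOn _)
    (fun i => quant_monoOn _) hai hbi hid hsl (trunc f c k) (fun x => c (min x k)) (c k)
    (fun x y hxy => hc (min_le_min_right _ hxy)) (fun x => hc0 _) hck hsl'
  have hΦ : Measurable fun v : Fin n → ℝ => trunc f c k (∑ i, v i) :=
    hcont.measurable.comp (Finset.measurable_fun_sum _ fun i _ => measurable_pi_apply i)
  have hma : Measurable fun (u : Fin n → ℝ) i => a i (u i) :=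
    measurable_pi_lambda _ fun i => (ham i).comp (measurable_pi_apply i)
  have hmb : Measurable fun (u : Fin n → ℝ) i => b i (u i) :=
    measurable_pi_lambda _ fun i => (hbm i).comp (measurable_pi_apply i)
  have eX : ∫ ω, trunc f c k (∑ i, X i ω) ∂μ = ∫ u, trunc f c k (∑ i, a i (u i)) ∂ρ := by
    have h1 := integral_map (μ := μ) (measurable_pi_lambda _ hXm).aemeasurable
      (hΦ.aestronglyMeasurable (μ := μ.map (fun ω i => X i ω)))
    have h2 := integral_map (μ := ρ) hma.aemeasurable (hΦ.aestronglyMeasurable)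
    exact h1.symm.trans ((congrArg (fun P => ∫ v, trunc f c k (∑ i, v i) ∂P) lawX).trans h2)
  have eY : ∫ ω, trunc f c k (∑ i, Y i ω) ∂ν = ∫ u, trunc f c k (∑ i, b i (u i)) ∂ρ := by
    have h1 := integral_map (μ := ν) (measurable_pi_lambda _ hYm).aemeasurable
      (hΦ.aestronglyMeasurable (μ := ν.map (fun ω i => Y i ω)))
    have h2 := integral_map (μ := ρ) hmb.aemeasurable (hΦ.aestronglyMeasurable)
    exact h1.symm.trans ((congrArg (fun P => ∫ v, trunc f c k (∑ i, v i) ∂P) lawY).trans h2)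
  rw [eX, eY]
  exact hchain
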